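/- Every diffeomorphic part admits a nonempty range of renormalizable peak-values: fix α > 1 and let φ be any C² diffeomorphism of [-1,1] onto itself with φ(-1) = -1, φ(1) = 1 and φ' > 0. Then there exists a nonempty open interval I ⊆ (0,1) such that for every t ∈ I the unimodal map f = φ ∘ q_t is period-doubling renormalizable: f has a fixed point p ∈ (0,1), f(0) > p and f(f(0)) > -p. -/

import Mathlib

/-- The canonical folding map with critical exponent `α` and peak-value `t`:
`q_t(x) = -2t|x|^α + 2t - 1` (here `^` is the real power). -/
noncomputable def foldMap (α t x : ℝ) : ℝ := -2 * t * |x| ^ α + 2 * t - 1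

/-- `IsDiffeo φ d1 d2` : `φ` is an orientation-preserving C² diffeomorphism of `[-1,1]`
onto itself fixing the endpoints, with first derivative `d1 > 0` and continuous second
derivative `d2`. -/
def IsDiffeo (φ d1 d2 : ℝ → ℝ) : Prop :=
  Set.BijOn φ (Set.Icc (-1 : ℝ) 1) (Set.Icc (-1 : ℝ) 1) ∧
  φ (-1) = -1 ∧ φ 1 = 1 ∧
  (∀ x ∈ Set.Icc (-1 : ℝ) 1, HasDerivWithinAt φ (d1 x) (Set.Icc (-1 : ℝ) 1) x) ∧
  (∀ x ∈ Set.Icc (-1 : ℝ) 1, HasDerivWithinAt d1 (d2 x) (Set.Icc (-1 : ℝ) 1) x) ∧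
  ContinuousOn d2 (Set.Icc (-1 : ℝ) 1) ∧
  (∀ x ∈ Set.Icc (-1 : ℝ) 1, 0 < d1 x)

/-- If `φ` is differentiable at a zero `c` and `α > 1`, then `(s + 1) φ(s)^α = o(s - c)`;
in particular it is below `s - c` immediately to the right of `c`. -/
lemma eventually_add_one_mul_rpow_lt_sub {α c d : ℝ} {φ : ℝ → ℝ} (hα : 1 < α)
    (hc : φ c = 0) (hd : HasDerivAt φ d c) :
    ∀ᶠ s in nhdsWithin c (Set.Ioi c), (s + 1) * φ s ^ α < s - c := by
  have hpow : HasDerivAt (fun s => φ s ^ α) 0 c := by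
    have h := hd.rpow_const (p := α) (Or.inr hα.le)
    rwa [hc, Real.zero_rpow (sub_pos.2 hα).ne', mul_zero] at h
  have hc' : φ c ^ α = 0 := by rw [hc, Real.zero_rpow (by linarith)]
  have hder : HasDerivAt (fun s => (s - c) - (s + 1) * φ s ^ α) 1 c := by
    have h := ((hasDerivAt_id' c).sub_const c).sub
      (((hasDerivAt_id' c).add_const 1).mul hpow)
    rwa [hc', mul_zero, mul_zero, add_zero, sub_zero] at h
  have hslope := (hasDerivAt_iff_tendsto_slope.1 hder).eventually (lt_mem_nhds one_pos)
  have hle : nhdsWithin c (Set.Ioi c) ≤ nhdsWithin c {c}ᶜ :=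
    nhdsWithin_mono c fun s hs => ne_of_gt hs
  filter_upwards [hle hslope, self_mem_nhdsWithin] with s hs hcs
  have hpos : 0 < s - c := sub_pos.2 hcs
  rw [slope_def_field, hc'] at hs
  have := (div_pos_iff_of_pos_right hpos).1 hs
  linarith

/-- Every diffeomorphic part admits a nonempty open interval of renormalizable peak-values:
for `α > 1` and any orientation-preserving C² diffeomorphism `φ` of `[-1,1]` fixing the
endpoints, there is a nonempty open interval `I ⊆ (0,1)` such that for every `t ∈ I` the
unimodal map `f = φ ∘ q_t` is period-doubling renormalizable: it has a fixed point
`p ∈ (0,1)` with `f 0 > p` and `f (f 0) > -p`. -/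
theorem renormalization_window_nonempty (α : ℝ) (hα : 1 < α)
    (φ d1 d2 : ℝ → ℝ) (hφ : IsDiffeo φ d1 d2) :
    ∃ a b : ℝ, a < b ∧ Set.Ioo a b ⊆ Set.Ioo (0 : ℝ) 1 ∧
      ∀ t ∈ Set.Ioo a b, ∃ p ∈ Set.Ioo (0 : ℝ) 1,
        φ (foldMap α t p) = p ∧
        p < φ (foldMap α t 0) ∧
        -p < φ (foldMap α t (φ (foldMap α t 0))) := by
  obtain ⟨hbij, hneg, hone, hd1, -, -, -⟩ := hφ
  have hcont : ContinuousOn φ (Set.Icc (-1) 1) := fun x hx => (hd1 x hx).continuousWithinAt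
  have hmono : StrictMonoOn φ (Set.Icc (-1) 1) :=
    hcont.strictMonoOn_of_injOn_Icc (by norm_num) (by rw [hneg, hone]; norm_num) hbij.injOn
  obtain ⟨c, hcI, hc⟩ := hbij.surjOn (show (0 : ℝ) ∈ Set.Icc (-1 : ℝ) 1 by norm_num)
  have hc1 : -1 < c := lt_of_le_of_ne hcI.1 (by rintro rfl; linarith)
  have hc2 : c < 1 := lt_of_le_of_ne hcI.2 (by rintro rfl; linarith)
  have hev := eventually_add_one_mul_rpow_lt_sub hα hc
    ((hd1 c hcI).hasDerivAt (Icc_mem_nhds hc1 hc2))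
  obtain ⟨u, ⟨hcu, hu1⟩, hu⟩ := (mem_nhdsGT_iff_exists_mem_Ioc_Ioo_subset hc2).1 hev
  refine ⟨(c + 1) / 2, (u + 1) / 2, by linarith,
    fun t ht => ⟨by linarith [ht.1], by linarith [ht.2]⟩, fun t ht => ?_⟩
  have hct : c < 2 * t - 1 := by linarith [ht.1]
  have htu : 2 * t - 1 < u := by linarith [ht.2]
  have hsmall : (2 * t - 1 + 1) * φ (2 * t - 1) ^ α < 2 * t - 1 - c := hu ⟨hct, htu⟩
  have hq0 : foldMap α t 0 = 2 * t - 1 := by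
    simp [foldMap, Real.zero_rpow (show α ≠ 0 by linarith)]
  have htI : 2 * t - 1 ∈ Set.Icc (-1 : ℝ) 1 := ⟨by linarith, by linarith⟩
  rw [hq0]
  set v := φ (2 * t - 1) with hv
  have hv0 : 0 < v := hc ▸ hmono hcI htI hct
  have hv1 : v < 1 := hone ▸ hmono htI (by norm_num) (by linarith)
  have hq : ∀ x ∈ Set.Icc 0 v, c < foldMap α t x ∧ foldMap α t x ≤ 2 * t - 1 := by
    intro x hx
    have hxv : x ^ α ≤ v ^ α := Real.rpow_le_rpow hx.1 hx.2 (by linarith)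
    have hx0 : 0 ≤ x ^ α := Real.rpow_nonneg hx.1 _
    rw [foldMap, abs_of_nonneg hx.1]
    constructor <;> nlinarith
  have hqI : Set.MapsTo (foldMap α t) (Set.Icc 0 v) (Set.Icc (-1) 1) := fun x hx =>
    ⟨by linarith [(hq x hx).1], by linarith [(hq x hx).2]⟩
  have hqv : foldMap α t v < 2 * t - 1 := by
    have : 0 < v ^ α := Real.rpow_pos_of_pos hv0 _
    rw [foldMap, abs_of_pos hv0]
    nlinarith
  have hvI : v ∈ Set.Icc 0 v := ⟨hv0.le, le_rfl⟩
  have hqcont : Continuous (foldMap α t) := by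
    unfold foldMap
    have : Continuous fun x : ℝ => |x| ^ α :=
      continuous_abs.rpow_const fun _ => Or.inr (by linarith)
    fun_prop
  have hgcont : ContinuousOn (fun x => φ (foldMap α t x) - x) (Set.Icc 0 v) :=
    (hcont.comp hqcont.continuousOn hqI).sub continuousOn_id
  have hg : (0 : ℝ) ∈ Set.Ioo (φ (foldMap α t v) - v) (φ (foldMap α t 0) - 0) := by
    rw [hq0]
    exact ⟨sub_neg.2 (hmono (hqI hvI) htI hqv), by linarith⟩
  obtain ⟨p, hp, hfix⟩ := intermediate_value_Ioo' hv0.le hgcont hg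
  refine ⟨p, ⟨hp.1, hp.2.trans hv1⟩, sub_eq_zero.1 hfix, hp.2, ?_⟩
  have hfv : 0 < φ (foldMap α t v) := hc ▸ hmono hcI (hqI hvI) (hq v hvI).1
  linarith [hp.1]
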